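/- arXiv:1803.01642 — 2 statements merged into one kernel-verified Lean document; each statement's English description precedes it below -/
import Mathlib

section
/- For every real number β there exists a constant c > 0 such that for every smooth function u : ℝ³ → ℝ with compact support contained in K one has ∫_K |x|^{2β−2} |u(x)|² dx ≤ c · ∫_K |x|^{2β} |∇u(x)|² dx. -/
open MeasureTheory

noncomputable section

/-- The space `ℝ³`. -/
abbrev E3 := EuclideanSpace ℝ (Fin 3)

/-- The function `|x| - ⟨x, p⟩`. -/
def hfun (p x : E3) : ℝ := ‖x‖ - ∑ j, p j * x j

/-- Components of the vector field `|x|^{2β} ∇ (log |x| - log (|x| - ⟨x,p⟩))`. -/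
def Ffun (β : ℝ) (p : E3) (i : Fin 3) (x : E3) : ℝ :=
  ‖x‖ ^ (2 * β) * (x i / ‖x‖ ^ 2 - (x i / ‖x‖ - p i) / hfun p x)

lemma hfun_contDiffAt (p x : E3) (hx : x ≠ 0) : ContDiffAt ℝ 1 (hfun p) x := by
  unfold hfun
  have h1 : ContDiffAt ℝ 1 (fun x : E3 => ‖x‖) x := contDiffAt_norm ℝ hx
  fun_prop

lemma Ffun_contDiffAt (β : ℝ) (p : E3) (i : Fin 3) (x : E3) (hx : x ≠ 0) (hh : hfun p x ≠ 0) :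
    ContDiffAt ℝ 1 (Ffun β p i) x := by
  unfold Ffun
  have h0 : ‖x‖ ≠ 0 := norm_ne_zero_iff.2 hx
  have h1 : ContDiffAt ℝ 1 (fun x : E3 => ‖x‖) x := contDiffAt_norm ℝ hx
  have h2 := hfun_contDiffAt p x hx
  have h3 : ContDiffAt ℝ 1 (fun x : E3 => x i) x := by fun_prop
  refine (h1.rpow_const_of_ne h0).mul ((h3.div (h1.pow 2) (by positivity)).sub
    (((h3.div h1 h0).sub contDiffAt_const).div h2 hh))

lemma normsq (x : E3) : ‖x‖ ^ 2 = x 0 ^ 2 + x 1 ^ 2 + x 2 ^ 2 := by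
  rw [EuclideanSpace.real_norm_sq_eq, Fin.sum_univ_three]

lemma curve_deriv (x : E3) (i j : Fin 3) :
    HasDerivAt (fun t : ℝ => (x + t • EuclideanSpace.single i (1:ℝ) : E3) j)
      (if j = i then 1 else 0) 0 := by
  have : (fun t : ℝ => (x + t • EuclideanSpace.single i (1:ℝ) : E3) j)
      = fun t => x j + t * (if j = i then 1 else 0) := by
    funext t
    simp
  rw [this]
  simpa using ((hasDerivAt_id (0:ℝ)).mul_const (if j = i then (1:ℝ) else 0)).const_add (x j)

lemma norm_deriv (x : E3) (hx : x ≠ 0) (i : Fin 3) :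
    HasDerivAt (fun t : ℝ => ‖x + t • EuclideanSpace.single i (1:ℝ)‖) (x i / ‖x‖) 0 := by
  have h0 : ‖x‖ ≠ 0 := norm_ne_zero_iff.2 hx
  have hc : HasDerivAt (fun t : ℝ => x + t • (EuclideanSpace.single i (1:ℝ) : E3))
      (EuclideanSpace.single i (1:ℝ)) 0 := by
    simpa using ((hasDerivAt_id (0:ℝ)).smul_const (EuclideanSpace.single i (1:ℝ) : E3)).const_add x
  have h2 := hc.norm_sq.sqrt (by simpa using h0)
  simp only [Real.sqrt_sq (norm_nonneg _)] at h2
  convert h2 using 1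
  simp [EuclideanSpace.inner_single_right]
  field_simp

lemma hfun_deriv (p x : E3) (hx : x ≠ 0) (i : Fin 3) :
    HasDerivAt (fun t : ℝ => hfun p (x + t • EuclideanSpace.single i (1:ℝ)))
      (x i / ‖x‖ - p i) 0 := by
  unfold hfun
  refine (norm_deriv x hx i).sub ?_
  have := HasDerivAt.fun_sum (u := Finset.univ) (x := (0:ℝ))
    (A := fun (j : Fin 3) (t : ℝ) => p j * (x + t • EuclideanSpace.single i (1:ℝ) : E3) j)
    (fun j _ => (curve_deriv x i j).const_mul (p j))
  convert this using 1
  simp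

/-- The diagonal derivative of the field. -/
def dF (β : ℝ) (p : E3) (i : Fin 3) (x : E3) : ℝ :=
  ‖x‖ ^ (2 * β) * (2 * β * x i / ‖x‖ ^ 2 * (x i / ‖x‖ ^ 2 - (x i / ‖x‖ - p i) / hfun p x)
    + (1 / ‖x‖ ^ 2 - 2 * x i ^ 2 / ‖x‖ ^ 4 - (1 / ‖x‖ - x i ^ 2 / ‖x‖ ^ 3) / hfun p x
      + (x i / ‖x‖ - p i) ^ 2 / hfun p x ^ 2))

lemma Ffun_deriv (β : ℝ) (p x : E3) (hx : x ≠ 0) (hh : hfun p x ≠ 0) (i : Fin 3) :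
    HasDerivAt (fun t : ℝ => Ffun β p i (x + t • EuclideanSpace.single i (1:ℝ)))
      (dF β p i x) 0 := by
  have h0 : ‖x‖ ≠ 0 := norm_ne_zero_iff.2 hx
  have hs := norm_deriv x hx i
  have hd := hfun_deriv p x hx i
  have hc := curve_deriv x i i
  have hr := hs.rpow_const (p := 2 * β) (Or.inl (by simpa using h0))
  have := hr.mul ((hc.div (hs.pow 2) (by simpa using h0)).sub
    (((hc.div hs (by simpa using h0)).sub (hasDerivAt_const (0:ℝ) (p i))).div hd (by simpa using hh)))
  refine this.congr_deriv ?_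
  simp only [dF, Pi.sub_apply, Pi.div_apply, Pi.pow_apply, zero_smul, add_zero, if_true,
    Real.rpow_sub_one h0]
  field_simp
  ring

lemma dF_sum (β : ℝ) (p x : E3) (hp : ‖p‖ = 1) (hx : x ≠ 0) (hh : hfun p x ≠ 0) :
    ∑ i, dF β p i x = ‖x‖ ^ (2 * β) / ‖x‖ ^ 2 := by
  have h0 : ‖x‖ ≠ 0 := norm_ne_zero_iff.2 hx
  have h1 := normsq x
  have h2 := normsq p
  rw [hp] at h2
  have h3 : hfun p x = ‖x‖ - (p 0 * x 0 + p 1 * x 1 + p 2 * x 2) := by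
    rw [hfun, Fin.sum_univ_three]
  simp only [Fin.sum_univ_three, dF]
  rw [← mul_add, ← mul_add, div_eq_mul_inv]
  congr 1
  generalize hfun p x = h at *
  generalize ‖x‖ = s at *
  have hV : x 0 * (x 0 / s ^ 2 - (x 0 / s - p 0) / h) + x 1 * (x 1 / s ^ 2 - (x 1 / s - p 1) / h)
      + x 2 * (x 2 / s ^ 2 - (x 2 / s - p 2) / h) = 0 := by
    have : x 0 * (x 0 / s ^ 2 - (x 0 / s - p 0) / h) + x 1 * (x 1 / s ^ 2 - (x 1 / s - p 1) / h)
      + x 2 * (x 2 / s ^ 2 - (x 2 / s - p 2) / h) = (x 0 ^ 2 + x 1 ^ 2 + x 2 ^ 2) / s ^ 2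
        - ((x 0 ^ 2 + x 1 ^ 2 + x 2 ^ 2) / s - (p 0 * x 0 + p 1 * x 1 + p 2 * x 2)) / h := by ring
    rw [this, ← h1, show p 0 * x 0 + p 1 * x 1 + p 2 * x 2 = s - h by linarith]
    field_simp
    ring
  have hW : (x 0 / s - p 0) ^ 2 + (x 1 / s - p 1) ^ 2 + (x 2 / s - p 2) ^ 2 = 2 * h / s := by
    have : (x 0 / s - p 0) ^ 2 + (x 1 / s - p 1) ^ 2 + (x 2 / s - p 2) ^ 2
      = (x 0 ^ 2 + x 1 ^ 2 + x 2 ^ 2) / s ^ 2 - 2 * (p 0 * x 0 + p 1 * x 1 + p 2 * x 2) / s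
        + (p 0 ^ 2 + p 1 ^ 2 + p 2 ^ 2) := by ring
    rw [this, ← h1, ← h2, show p 0 * x 0 + p 1 * x 1 + p 2 * x 2 = s - h by linarith]
    field_simp
    ring
  have : (2 * β / s ^ 2) * (x 0 * (x 0 / s ^ 2 - (x 0 / s - p 0) / h) + x 1 * (x 1 / s ^ 2 - (x 1 / s - p 1) / h)
      + x 2 * (x 2 / s ^ 2 - (x 2 / s - p 2) / h)) +
      (3 / s ^ 2 - 2 * (x 0 ^ 2 + x 1 ^ 2 + x 2 ^ 2) / s ^ 4
      - (3 / s - (x 0 ^ 2 + x 1 ^ 2 + x 2 ^ 2) / s ^ 3) / h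
      + ((x 0 / s - p 0) ^ 2 + (x 1 / s - p 1) ^ 2 + (x 2 / s - p 2) ^ 2) / h ^ 2) = (s ^ 2)⁻¹ := by
    rw [hV, hW, ← h1]
    field_simp
    ring
  refine Eq.trans ?_ this
  ring

lemma coord_le (x : E3) (i : Fin 3) : |x i| ≤ ‖x‖ := by
  simpa using PiLp.norm_apply_le x i

lemma Ffun_bound (β : ℝ) (p x : E3) (hp : ‖p‖ = 1) (hx : x ≠ 0) (δ : ℝ) (hδ : 0 < δ)
    (hh : δ * ‖x‖ ≤ hfun p x) (i : Fin 3) :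
    |Ffun β p i x| ≤ (1 + 2 / δ) * (‖x‖ ^ (2 * β) / ‖x‖) := by
  have h0 : 0 < ‖x‖ := norm_pos_iff.2 hx
  have hxi := coord_le x i
  have hpi := coord_le p i
  rw [hp] at hpi
  have hpos : 0 < hfun p x := lt_of_lt_of_le (by positivity) hh
  have ha : 0 < ‖x‖ ^ (2 * β) := Real.rpow_pos_of_pos h0 _
  rw [Ffun, abs_mul, abs_of_pos ha]
  have e1 : |x i / ‖x‖ ^ 2| ≤ 1 / ‖x‖ := by
    rw [abs_div, abs_of_pos (by positivity : 0 < ‖x‖ ^ 2), div_le_div_iff₀ (by positivity) h0]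
    nlinarith
  have e2 : |x i / ‖x‖ - p i| ≤ 2 := by
    have : |x i / ‖x‖| ≤ 1 := by
      rw [abs_div, abs_of_pos h0]
      exact div_le_one_of_le₀ hxi h0.le
    have := abs_sub (x i / ‖x‖) (p i)
    linarith
  have e3 : |(x i / ‖x‖ - p i) / hfun p x| ≤ 2 / (δ * ‖x‖) := by
    rw [abs_div, abs_of_pos hpos]
    gcongr
  have e4 : |x i / ‖x‖ ^ 2 - (x i / ‖x‖ - p i) / hfun p x| ≤ 1 / ‖x‖ + 2 / (δ * ‖x‖) :=
    (abs_sub _ _).trans (by linarith)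
  calc _ ≤ ‖x‖ ^ (2 * β) * (1 / ‖x‖ + 2 / (δ * ‖x‖)) := by gcongr
    _ = _ := by field_simp

/-- The derivative of a compactly supported `C¹` function integrates to zero. -/
lemma integral_deriv_zero (G : E3 → ℝ) (hG : ContDiff ℝ 1 G) (hc : HasCompactSupport G) (v : E3) :
    Integrable (fun x => fderiv ℝ G x v) ∧ ∫ x, fderiv ℝ G x v = 0 := by
  have hi : Integrable (fun x => fderiv ℝ G x v) :=
    ((hG.continuous_fderiv (by norm_num)).clm_apply continuous_const).integrable_of_hasCompactSupport
      (hc.fderiv_apply ℝ v)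
  refine ⟨hi, ?_⟩
  have := integral_mul_fderiv_eq_neg_fderiv_mul_of_integrable (μ := (volume : Measure E3))
    (f := fun _ => (1:ℝ)) (g := G) (v := v) (by simp) (by simpa using hi)
    (by simpa using hG.continuous.integrable_of_hasCompactSupport hc)
    (fun _ _ => by fun_prop) (fun x _ => hG.differentiable (by norm_num) x)
  simpa using this

lemma key (β : ℝ) (p : E3) (hp : ‖p‖ = 1) (δ : ℝ) (hδ : 0 < δ) (u : E3 → ℝ)
    (hu : ContDiff ℝ 1 u) (hc : HasCompactSupport u)
    (hs : ∀ x ∈ tsupport u, x ≠ 0 ∧ δ * ‖x‖ ≤ hfun p x) :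
    ∫ x, ‖x‖ ^ (2 * β - 2) * |u x| ^ 2
      ≤ (36 * (1 + 2 / δ) ^ 2) * ∫ x, ‖x‖ ^ (2 * β) * ‖gradient u x‖ ^ 2 := by
  set M := 1 + 2 / δ with hM
  have hpos : ∀ x ∈ tsupport u, hfun p x ≠ 0 := fun x hx =>
    (lt_of_lt_of_le (mul_pos hδ (norm_pos_iff.2 (hs x hx).1)) (hs x hx).2).ne'
  let G : Fin 3 → E3 → ℝ := fun i x => Ffun β p i x * u x ^ 2
  have supp : ∀ (w g : E3 → ℝ), (∀ x ∉ tsupport u, g x = 0) →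
      tsupport (fun x => w x * g x) ⊆ tsupport u := by
    intro w g hg
    refine closure_minimal (fun x hx => ?_) (isClosed_tsupport u)
    by_contra hxu
    exact hx (by simp [hg x hxu])
  have hu0 : ∀ x ∉ tsupport u, u x = 0 := fun x hx => image_eq_zero_of_notMem_tsupport hx
  have hgrad : ∀ x, ‖gradient u x‖ = ‖fderiv ℝ u x‖ := fun x => by
    simp [gradient]
  have hg0 : ∀ x ∉ tsupport u, fderiv ℝ u x = 0 := fun x hx => by
    by_contra h
    exact hx (support_fderiv_subset ℝ h)
  have hu1 : ∀ x ∉ tsupport u, u x ^ 2 = 0 := fun x hx => by simp [hu0 x hx]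
  have hGs : ∀ i, tsupport (G i) ⊆ tsupport u := fun i => supp _ _ hu1
  have hGc : ∀ i, HasCompactSupport (G i) := fun i =>
    hc.of_isClosed_subset (isClosed_tsupport _) (hGs i)
  have hGd : ∀ i, ContDiff ℝ 1 (G i) := fun i => by
    rw [contDiff_iff_contDiffAt]
    intro x
    by_cases hx : x ∈ tsupport u
    · exact (Ffun_contDiffAt β p i x (hs x hx).1 (hpos x hx)).mul (hu.contDiffAt.pow 2)
    · have : G i =ᶠ[nhds x] fun _ => 0 :=
        notMem_tsupport_iff_eventuallyEq.1 (fun h => hx (hGs i h))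
      exact contDiffAt_const.congr_of_eventuallyEq this
  have hnc : ∀ (γ : ℝ), ∀ x ∈ tsupport u, ContinuousAt (fun x : E3 => ‖x‖ ^ γ) x := fun γ x hx =>
    continuous_norm.continuousAt.rpow_const (Or.inl (norm_ne_zero_iff.2 (hs x hx).1))
  have intg : ∀ (γ : ℝ) (g : E3 → ℝ), Continuous g → (∀ x ∉ tsupport u, g x = 0) →
      Integrable (fun x => ‖x‖ ^ γ * g x) := by
    intro γ g hg h0
    have hsub := supp (fun x => ‖x‖ ^ γ) g h0
    refine Continuous.integrable_of_hasCompactSupport (continuous_of_tsupport fun x hx => ?_)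
      (hc.of_isClosed_subset (isClosed_tsupport _) hsub)
    exact (hnc γ x (hsub hx)).mul hg.continuousAt
  have iA : Integrable (fun x => ‖x‖ ^ (2 * β - 2) * |u x| ^ 2) :=
    intg _ _ (hu.continuous.abs.pow 2) (fun x hx => by simp [hu0 x hx])
  have iB : Integrable (fun x => ‖x‖ ^ (2 * β) * ‖gradient u x‖ ^ 2) := by
    simp only [hgrad]
    exact intg _ _ ((hu.continuous_fderiv (by norm_num)).norm.pow 2)
      (fun x hx => by simp [hg0 x hx])
  let e : Fin 3 → E3 := fun i => EuclideanSpace.single i (1:ℝ)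
  have hD := fun i => integral_deriv_zero (G i) (hGd i) (hGc i) (e i)
  have hDsum : ∫ x, ∑ i, fderiv ℝ (G i) x (e i) = 0 := by
    rw [integral_finsetSum _ (fun i _ => (hD i).1)]
    exact Finset.sum_eq_zero fun i _ => (hD i).2
  have hpt : ∀ x, 2⁻¹ * (‖x‖ ^ (2 * β - 2) * |u x| ^ 2)
      - (18 * M ^ 2) * (‖x‖ ^ (2 * β) * ‖gradient u x‖ ^ 2) ≤ ∑ i, fderiv ℝ (G i) x (e i) := by
    intro x
    by_cases hx : x ∈ tsupport u
    · have hx0 := (hs x hx).1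
      have h0 : 0 < ‖x‖ := norm_pos_iff.2 hx0
      have hder : ∀ i, fderiv ℝ (G i) x (e i)
          = dF β p i x * u x ^ 2 + Ffun β p i x * (2 * u x * fderiv ℝ u x (e i)) := by
        intro i
        have h1 : HasDerivAt (fun t : ℝ => G i (x + t • e i)) (fderiv ℝ (G i) x (e i)) 0 :=
          (((hGd i).differentiable (by norm_num) x).hasFDerivAt).hasLineDerivAt (e i)
        have h2 : HasDerivAt (fun t : ℝ => u (x + t • e i)) (fderiv ℝ u x (e i)) 0 :=
          ((hu.differentiable (by norm_num) x).hasFDerivAt).hasLineDerivAt (e i)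
        have h3 := (Ffun_deriv β p x hx0 (hpos x hx) i).mul (h2.pow 2)
        refine h1.unique (h3.congr_deriv ?_)
        simp [e]
      have hsum : ∑ i, fderiv ℝ (G i) x (e i) = ‖x‖ ^ (2 * β) / ‖x‖ ^ 2 * u x ^ 2
          + 2 * u x * ∑ i, Ffun β p i x * fderiv ℝ u x (e i) := by
        rw [← dF_sum β p x hp hx0 (hpos x hx), Finset.sum_mul, Finset.mul_sum,
          ← Finset.sum_add_distrib]
        refine Finset.sum_congr rfl fun i _ => ?_
        rw [hder i]
        ring
      have ha : 0 < ‖x‖ ^ (2 * β) := Real.rpow_pos_of_pos h0 _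
      have hMp : 0 < M := by positivity
      have hbd : |∑ i, Ffun β p i x * fderiv ℝ u x (e i)|
          ≤ 3 * (M * (‖x‖ ^ (2 * β) / ‖x‖) * ‖gradient u x‖) := by
        refine (Finset.abs_sum_le_sum_abs _ _).trans ?_
        have : ∀ i ∈ (Finset.univ : Finset (Fin 3)), |Ffun β p i x * fderiv ℝ u x (e i)|
            ≤ M * (‖x‖ ^ (2 * β) / ‖x‖) * ‖gradient u x‖ := by
          intro i _
          rw [abs_mul]
          have b1 := Ffun_bound β p x hp hx0 δ hδ (hs x hx).2 i
          have b2 : |fderiv ℝ u x (e i)| ≤ ‖gradient u x‖ := by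
            rw [hgrad]
            have := (fderiv ℝ u x).le_opNorm (e i)
            simpa [e] using this
          exact mul_le_mul b1 b2 (abs_nonneg _) (by positivity)
        refine (Finset.sum_le_sum this).trans ?_
        simp
      rw [hsum, Real.rpow_sub h0, show ‖x‖ ^ (2:ℝ) = ‖x‖ ^ 2 by norm_cast]
      set S := ∑ i, Ffun β p i x * fderiv ℝ u x (e i)
      set a := ‖x‖ ^ (2 * β)
      set g := ‖gradient u x‖
      set s := ‖x‖
      have k1 : -(|u x| * (3 * (M * (a / s) * g))) ≤ u x * S := by
        have := neg_abs_le (u x * S)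
        rw [abs_mul] at this
        have := mul_le_mul_of_nonneg_left hbd (abs_nonneg (u x))
        linarith
      have k2 : 0 ≤ 2⁻¹ * a * (|u x| / s - 6 * M * g) ^ 2 := by positivity
      have k3 : 2⁻¹ * a * (|u x| / s - 6 * M * g) ^ 2 = 2⁻¹ * (a / s ^ 2 * |u x| ^ 2)
        - 2 * (|u x| * (3 * (M * (a / s) * g))) + 18 * M ^ 2 * (a * g ^ 2) := by
        ring
      rw [k3] at k2
      rw [sq_abs] at *
      linarith
    · have : ∀ i, fderiv ℝ (G i) x = 0 := fun i => by
        by_contra h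
        exact hx (hGs i (support_fderiv_subset ℝ h))
      simp [this, hu0 x hx, hgrad, hg0 x hx]
  have hfin := integral_mono ((iA.const_mul 2⁻¹).sub (iB.const_mul (18 * M ^ 2)))
    (integrable_finsetSum _ fun i _ => (hD i).1) hpt
  rw [hDsum] at hfin
  simp only [Pi.sub_apply] at hfin
  rw [integral_sub (iA.const_mul 2⁻¹) (iB.const_mul (18 * M ^ 2)), integral_const_mul,
    integral_const_mul] at hfin
  linarith

end

/-- Hardy-type inequality on the cone `K` over `Ω`: for every real `β`
there is a constant `c > 0` such that
`∫_K |x|^{2β−2} |u(x)|² dx ≤ c ∫_K |x|^{2β} |∇u(x)|² dx`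
for all smooth `u` with compact support contained in `K`. -/
theorem statement3
    (Ω : Set (EuclideanSpace ℝ (Fin 3)))
    (hΩsub : Ω ⊆ Metric.sphere 0 1)
    (hΩne : Ω.Nonempty)
    (hΩopen : ∃ U : Set (EuclideanSpace ℝ (Fin 3)), IsOpen U ∧ Ω = U ∩ Metric.sphere 0 1)
    (hΩcl : closure Ω ⊂ Metric.sphere 0 1)
    (K : Set (EuclideanSpace ℝ (Fin 3)))
    (hK : K = {x | x ≠ 0 ∧ ‖x‖⁻¹ • x ∈ Ω})
    (β : ℝ) :
    ∃ c > (0 : ℝ), ∀ u : EuclideanSpace ℝ (Fin 3) → ℝ,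
      ContDiff ℝ (⊤ : ℕ∞) u → HasCompactSupport u → tsupport u ⊆ K →
      ∫ x in K, ‖x‖ ^ (2 * β - 2) * |u x| ^ 2
        ≤ c * ∫ x in K, ‖x‖ ^ (2 * β) * ‖gradient u x‖ ^ 2 := by
  obtain ⟨p, hpS, hpc⟩ := Set.exists_of_ssubset hΩcl
  have hp : ‖p‖ = 1 := by simpa using hpS
  obtain ⟨ε, hε, hball⟩ := Metric.isOpen_iff.1 isClosed_closure.isOpen_compl p hpc
  have hδ : 0 < ε ^ 2 / 2 := by positivity
  refine ⟨36 * (1 + 2 / (ε ^ 2 / 2)) ^ 2, by positivity, fun u hu hc hs => ?_⟩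
  have hK' : ∀ x ∈ K, x ≠ 0 ∧ ε ^ 2 / 2 * ‖x‖ ≤ hfun p x := by
    intro x hx
    rw [hK] at hx
    obtain ⟨hx0, hxΩ⟩ := hx
    refine ⟨hx0, ?_⟩
    have h0 : 0 < ‖x‖ := norm_pos_iff.2 hx0
    have hd : ε ≤ ‖‖x‖⁻¹ • x - p‖ := by
      by_contra hlt
      have := hball (a := ‖x‖⁻¹ • x) (by rw [Metric.mem_ball, dist_eq_norm]; linarith)
      exact this (subset_closure hxΩ)
    have h1 : ‖‖x‖⁻¹ • x - p‖ ^ 2 = 2 - 2 * (‖x‖⁻¹ * ∑ j, p j * x j) := by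
      rw [norm_sub_sq_real, norm_smul, inner_smul_left, hp]
      simp only [PiLp.inner_apply, norm_inv, norm_norm, RCLike.inner_apply, conj_trivial]
      rw [inv_mul_cancel₀ h0.ne']
      ring
    have h2 : ε ^ 2 ≤ 2 - 2 * (‖x‖⁻¹ * ∑ j, p j * x j) := by
      rw [← h1]
      gcongr
    have h3 : ‖x‖ * (‖x‖⁻¹ * ∑ j, p j * x j) = ∑ j, p j * x j := by
      field_simp
    have h4 := mul_le_mul_of_nonneg_left h2 h0.le
    rw [hfun]
    linarith
  have hout : ∀ x ∉ K, x ∉ tsupport u := fun x hx h => hx (hs h)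
  rw [setIntegral_eq_integral_of_forall_compl_eq_zero
      (fun x hx => by simp [image_eq_zero_of_notMem_tsupport (hout x hx)]),
    setIntegral_eq_integral_of_forall_compl_eq_zero (fun x hx => by
      have : fderiv ℝ u x = 0 := by
        by_contra h
        exact hout x hx (support_fderiv_subset ℝ h)
      simp [gradient, this])]
  exact key β p hp _ hδ u (hu.of_le (by exact_mod_cast le_top)) hc (fun x hx => hK' x (hs hx))
end

section
/- For every real number β there exist constants c₁, c₂ > 0 such that for every smooth function u : ℝ³ → ℝ with compact support contained in K one has c₁ · ∫_K ((|x|^{2β} + |x|^{2β−2})|u(x)|² + |x|^{2β}|∇u(x)|²) dx ≤ ∫_K |x|^{2β} (|u(x)|² + |∇u(x)|²) dx ≤ c₂ · ∫_K ((|x|^{2β} + |x|^{2β−2})|u(x)|² + |x|^{2β}|∇u(x)|²) dx; that is, on smooth functions compactly supported in K the norm (∫_K |x|^{2β}(|u|² + |∇u|²) dx)^{1/2} is equivalent to the E_β^1(K)-norm. -/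
open MeasureTheory

namespace S4

abbrev E := EuclideanSpace ℝ (Fin 3)

lemma integral_fderiv_zero (h : E → ℝ) (hh : ContDiff ℝ 1 h) (hc : HasCompactSupport h) (v : E) :
    Integrable (fun x => fderiv ℝ h x v) ∧ ∫ x, fderiv ℝ h x v = 0 := by
  have hi : Integrable (fun x => fderiv ℝ h x v) := by
    apply Continuous.integrable_of_hasCompactSupport
    · exact (hh.continuous_fderiv (by norm_num)).clm_apply continuous_const
    · exact hc.fderiv_apply (𝕜 := ℝ) v
  refine ⟨hi, ?_⟩
  have := integral_mul_fderiv_eq_neg_fderiv_mul_of_integrable (𝕜 := ℝ) (μ := (volume : Measure E))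
    (f := h) (g := fun _ => (1:ℝ)) (v := v) (by simpa using hi) (by simp)
    (by simpa using hh.continuous.integrable_of_hasCompactSupport hc)
    (fun x _ => hh.differentiable (by norm_num) x) (by fun_prop)
  simp at this
  linarith

/-- cutoff smoothness -/
lemma contDiff_cut (u f : E → ℝ) (hf : ∀ x ∈ tsupport u, ContDiffAt ℝ 1 f x)
    (h0 : ∀ x, x ∉ tsupport u → f x = 0) : ContDiff ℝ 1 f := by
  rw [contDiff_iff_contDiffAt]
  intro x
  by_cases hx : x ∈ tsupport u
  · exact hf x hx
  · have : f =ᶠ[nhds x] fun _ => 0 := by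
      filter_upwards [(isClosed_tsupport u).isOpen_compl.mem_nhds hx] with y hy
      exact h0 y hy
    exact contDiffAt_const.congr_of_eventuallyEq this

lemma integrable_cut (u f : E → ℝ) (hu : HasCompactSupport u)
    (hf : ∀ x ∈ tsupport u, ContinuousAt f x)
    (h0 : ∀ x, x ∉ tsupport u → f x = 0) : Integrable f := by
  apply Continuous.integrable_of_hasCompactSupport
  · rw [continuous_iff_continuousAt]
    intro x
    by_cases hx : x ∈ tsupport u
    · exact hf x hx
    · have : f =ᶠ[nhds x] fun _ => 0 := by
        filter_upwards [(isClosed_tsupport u).isOpen_compl.mem_nhds hx] with y hy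
        exact h0 y hy
      exact continuousAt_const.congr this.symm
  · exact HasCompactSupport.intro' hu (isClosed_tsupport u) h0

noncomputable def A (β : ℝ) (q x : E) : ℝ :=
  ‖x‖ ^ (2*β-2) - ‖x‖ ^ (2*β-1) / (‖x‖ + inner ℝ q x)
noncomputable def B (β : ℝ) (q x : E) : ℝ :=
  - (‖x‖ ^ (2*β) / (‖x‖ + inner ℝ q x))

lemma hasFDerivAt_norm' (x : E) (hx : x ≠ 0) :
    HasFDerivAt (fun y : E => ‖y‖) (‖x‖⁻¹ • innerSL ℝ x) x := by
  have h := (hasStrictFDerivAt_norm_sq x).hasFDerivAt.sqrt (by simpa using hx)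
  have e : (fun y : E => √(‖y‖^2)) = fun y => ‖y‖ := by ext; simp
  rw [e] at h
  have e2 : (1 / (2 * √(‖x‖ ^ 2))) • 2 • (innerSL ℝ) x = ‖x‖⁻¹ • innerSL ℝ x := by
    ext v
    simp
    ring
  rw [e2] at h
  exact h

lemma AB (β : ℝ) (q x : E) (hq : ‖q‖ = 1) (hx : x ≠ 0) (hp : 0 < ‖x‖ + inner ℝ q x) :
    ∃ A' B' : E →L[ℝ] ℝ, HasFDerivAt (A β q) A' x ∧ HasFDerivAt (B β q) B' x ∧
      3 * A β q x + A' x + B' q = ‖x‖ ^ (2*β-2) := by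
  have hN : 0 < ‖x‖ := norm_pos_iff.2 hx
  have hn := hasFDerivAt_norm' x hx
  have hs : HasFDerivAt (fun y : E => inner ℝ q y) (innerSL ℝ q) x := (innerSL ℝ q).hasFDerivAt
  have hr : ∀ p : ℝ, HasFDerivAt (fun y : E => ‖y‖ ^ p) ((p * ‖x‖^(p-1)) • (‖x‖⁻¹ • innerSL ℝ x)) x :=
    fun p => hn.rpow_const (Or.inl hN.ne')
  have hd := (hn.add hs)
  refine ⟨_, _, (hr (2*β-2)).sub ((hr (2*β-1)).mul ((hasDerivAt_inv hp.ne').comp_hasFDerivAt x hd)),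
    ((hr (2*β)).mul ((hasDerivAt_inv hp.ne').comp_hasFDerivAt x hd)).neg, ?_⟩
  have e1 : ‖x‖ ^ (2*β) = ‖x‖ ^ (2*β-2) * ‖x‖^2 := by
    rw [← Real.rpow_natCast, ← Real.rpow_add hN]; norm_num
  have e2 : ‖x‖ ^ (2*β-1) = ‖x‖ ^ (2*β-2) * ‖x‖ := by
    rw [← Real.rpow_add_one hN.ne']; ring_nf
  have e3 : ‖x‖ ^ (2*β-2-1) = ‖x‖ ^ (2*β-2) * ‖x‖⁻¹ := by
    rw [Real.rpow_sub_one hN.ne']; ring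
  have e4 : ‖x‖ ^ (2*β-1-1) = ‖x‖ ^ (2*β-2) := by ring_nf
  simp [A, e1, e2, e3, e4, hq, real_inner_comm q x]
  generalize ‖x‖ ^ (2*β-2) = R
  generalize hse : inner ℝ q x = s at *
  generalize ‖x‖ = N at *
  field_simp
  ring


lemma sum_apply (L : E →L[ℝ] ℝ) (v : E) :
    ∑ i, v i * L (EuclideanSpace.single i 1) = L v := by
  have : v = ∑ i, v i • EuclideanSpace.single i (1:ℝ) := by
    ext j
    simp [Pi.single_apply]
  conv_rhs => rw [this]
  simp

noncomputable def H (β : ℝ) (q : E) (u : E → ℝ) (i : Fin 3) (y : E) : ℝ :=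
  u y ^ 2 * (A β q y * y i + B β q y * q i)

lemma div_H (β : ℝ) (q x : E) (u : E → ℝ) (hq : ‖q‖ = 1) (hx : x ≠ 0)
    (hp : 0 < ‖x‖ + inner ℝ q x) (hu : DifferentiableAt ℝ u x) :
    ∑ i, fderiv ℝ (H β q u i) x (EuclideanSpace.single i 1) =
      ‖x‖ ^ (2*β-2) * u x ^ 2 + 2 * u x * fderiv ℝ u x (A β q x • x + B β q x • q) := by
  obtain ⟨A', B', hA, hB, hAB⟩ := AB β q x hq hx hp
  have hi : ∀ i, fderiv ℝ (H β q u i) x (EuclideanSpace.single i 1) =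
      u x ^ 2 * (x i * A' (EuclideanSpace.single i 1) + A β q x
        + q i * B' (EuclideanSpace.single i 1))
      + 2 * u x * (A β q x * (x i * fderiv ℝ u x (EuclideanSpace.single i 1))
        + B β q x * (q i * fderiv ℝ u x (EuclideanSpace.single i 1))) := by
    intro i
    have hc : HasFDerivAt (fun y : E => y i) (EuclideanSpace.proj i : E →L[ℝ] ℝ) x :=
      (EuclideanSpace.proj i : E →L[ℝ] ℝ).hasFDerivAt
    have := (hu.hasFDerivAt.pow 2).mul ((hA.mul hc).add (hB.mul_const (q i)))
    have e : fderiv ℝ (H β q u i) x = _ := this.fderiv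
    rw [e]
    simp
    ring
  simp_rw [hi]
  rw [Finset.sum_add_distrib, ← Finset.mul_sum, ← Finset.mul_sum, Finset.sum_add_distrib,
    Finset.sum_add_distrib, Finset.sum_add_distrib, ← Finset.mul_sum, ← Finset.mul_sum,
    sum_apply, sum_apply, sum_apply, sum_apply, ← hAB]
  simp
  ring

lemma bound_F (β δ : ℝ) (q x : E) (hq : ‖q‖ = 1) (hx : x ≠ 0) (hδ : 0 < δ)
    (hp : δ * ‖x‖ ≤ ‖x‖ + inner ℝ q x) :
    ‖A β q x • x + B β q x • q‖ ≤ (1 + 2/δ) * ‖x‖ ^ (2*β-1) := by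
  have hN : 0 < ‖x‖ := norm_pos_iff.2 hx
  have hD : 0 < ‖x‖ + inner ℝ q x := lt_of_lt_of_le (by positivity) hp
  have e1 : ‖x‖ ^ (2*β) = ‖x‖ ^ (2*β-1) * ‖x‖ := by
    rw [← Real.rpow_add_one hN.ne']; ring_nf
  have e2 : ‖x‖ ^ (2*β-1) = ‖x‖ ^ (2*β-2) * ‖x‖ := by
    rw [← Real.rpow_add_one hN.ne']; ring_nf
  have hR : 0 < ‖x‖ ^ (2*β-1) := by positivity
  have hR2 : 0 < ‖x‖ ^ (2*β-2) := by positivity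
  have hb : ‖x‖ ^ (2*β) / (‖x‖ + inner ℝ q x) ≤ ‖x‖ ^ (2*β-1) / δ := by
    rw [div_le_div_iff₀ hD hδ, e1]
    nlinarith
  have hb0 : 0 < ‖x‖ ^ (2*β) / (‖x‖ + inner ℝ q x) := by positivity
  have hB : |B β q x| ≤ ‖x‖ ^ (2*β-1) / δ := by
    rw [B, abs_neg, abs_of_pos hb0]; exact hb
  have hA : |A β q x| * ‖x‖ ≤ ‖x‖ ^ (2*β-1) + ‖x‖ ^ (2*β-1) / δ := by
    rw [← abs_of_pos hN, ← abs_mul, abs_of_pos hN]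
    have : A β q x * ‖x‖ = ‖x‖ ^ (2*β-1) - ‖x‖ ^ (2*β) / (‖x‖ + inner ℝ q x) := by
      rw [A, e1, e2]; ring
    rw [this, abs_le]
    constructor <;> linarith
  calc _ ≤ ‖A β q x • x‖ + ‖B β q x • q‖ := norm_add_le _ _
    _ = |A β q x| * ‖x‖ + |B β q x| := by simp [norm_smul, hq]
    _ ≤ _ := by
      have : (1 + 2/δ) * ‖x‖ ^ (2*β-1) = ‖x‖ ^ (2*β-1) + ‖x‖ ^ (2*β-1) / δ + ‖x‖ ^ (2*β-1) / δ := by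
        ring
      linarith

lemma pointwise (β δ : ℝ) (q x : E) (u : E → ℝ) (hq : ‖q‖ = 1) (hx : x ≠ 0) (hδ : 0 < δ)
    (hp : δ * ‖x‖ ≤ ‖x‖ + inner ℝ q x) (hu : DifferentiableAt ℝ u x) :
    ‖x‖ ^ (2*β-2) * u x ^ 2 ≤
      2 * ∑ i, fderiv ℝ (H β q u i) x (EuclideanSpace.single i 1)
      + 4 * (1 + 2/δ)^2 * (‖x‖ ^ (2*β) * ‖fderiv ℝ u x‖ ^ 2) := by
  have hN : 0 < ‖x‖ := norm_pos_iff.2 hx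
  have hD : 0 < ‖x‖ + inner ℝ q x := lt_of_lt_of_le (by positivity) hp
  rw [div_H β q x u hq hx hD hu]
  have h1 : |fderiv ℝ u x (A β q x • x + B β q x • q)| ≤
      ‖fderiv ℝ u x‖ * ((1 + 2/δ) * ‖x‖ ^ (2*β-1)) :=
    ((fderiv ℝ u x).le_opNorm _).trans (by gcongr; exact bound_F β δ q x hq hx hδ hp)
  have e1 : ‖x‖ ^ (2*β) = ‖x‖ ^ (2*β-2) * ‖x‖^2 := by
    rw [← Real.rpow_natCast, ← Real.rpow_add hN]; norm_num
  have e2 : ‖x‖ ^ (2*β-1) = ‖x‖ ^ (2*β-2) * ‖x‖ := by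
    rw [← Real.rpow_add_one hN.ne']; ring_nf
  have h2 : |u x * fderiv ℝ u x (A β q x • x + B β q x • q)| ≤
      |u x| * (‖fderiv ℝ u x‖ * ((1 + 2/δ) * ‖x‖ ^ (2*β-1))) := by
    rw [abs_mul]; gcongr
  have h3 := (abs_le.1 h2).1
  have hR2 : 0 < ‖x‖ ^ (2*β-2) := by positivity
  rw [e2] at h3
  rw [e1, ← sq_abs (u x)]
  have h4 := mul_nonneg hR2.le (sq_nonneg (|u x| - 2 * (1+2/δ) * ‖x‖ * ‖fderiv ℝ u x‖))
  nlinarith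

lemma contDiffAt_H (β : ℝ) (q x : E) (u : E → ℝ) (hx : x ≠ 0)
    (hp : 0 < ‖x‖ + inner ℝ q x) (hu : ContDiffAt ℝ 1 u x) (i : Fin 3) :
    ContDiffAt ℝ 1 (H β q u i) x := by
  have hN : ‖x‖ ≠ 0 := norm_ne_zero_iff.2 hx
  have hn : ContDiffAt ℝ 1 (fun y : E => ‖y‖) x := contDiffAt_norm ℝ hx
  have hr : ∀ p : ℝ, ContDiffAt ℝ 1 (fun y : E => ‖y‖ ^ p) x :=
    fun p => hn.rpow_const_of_ne hN
  have hs : ContDiffAt ℝ 1 (fun y : E => (inner ℝ q y : ℝ)) x := (innerSL ℝ q).contDiff.contDiffAt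
  have hd := hn.add hs
  have hc : ContDiffAt ℝ 1 (fun y : E => y i) x := by fun_prop
  exact (hu.pow 2).mul ((((hr (2*β-2)).sub ((hr (2*β-1)).div hd hp.ne')).mul hc).add
    ((((hr (2*β)).div hd hp.ne').neg).mul contDiffAt_const))

lemma norm_gradient (u : E → ℝ) (x : E) : ‖gradient u x‖ = ‖fderiv ℝ u x‖ := by
  simp [gradient]

lemma cone_bound (Ω : Set E) (hΩsub : Ω ⊆ Metric.sphere 0 1)
    (hΩcl : closure Ω ⊂ Metric.sphere 0 1) :
    ∃ q : E, ‖q‖ = 1 ∧ ∃ δ > 0, ∀ x : E, x ≠ 0 → ‖x‖⁻¹ • x ∈ Ω →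
      δ * ‖x‖ ≤ ‖x‖ + inner ℝ q x := by
  obtain ⟨p, hp, hpc⟩ := Set.exists_of_ssubset hΩcl
  rw [Metric.mem_closure_iff] at hpc
  push Not at hpc
  obtain ⟨ε, hε, hb⟩ := hpc
  have hp1 : ‖p‖ = 1 := by simpa using hp
  refine ⟨-p, by simpa using hp1, ε^2/2, by positivity, fun x hx hxΩ => ?_⟩
  have hN : 0 < ‖x‖ := norm_pos_iff.2 hx
  have h1 := hb _ hxΩ
  have hy : ‖‖x‖⁻¹ • x‖ = 1 := by simpa using hΩsub hxΩ
  rw [dist_eq_norm] at h1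
  have h2 : ε^2 ≤ ‖p - ‖x‖⁻¹ • x‖^2 := by gcongr
  rw [norm_sub_sq_real, hp1, hy, inner_smul_right] at h2
  rw [inner_neg_left]
  have h3 : ‖x‖ * (‖x‖⁻¹ * inner ℝ p x) = inner ℝ p x := by field_simp
  nlinarith

end S4

/-- on smooth functions compactly supported in the cone `K`, the norm
`(∫_K |x|^{2β}(|u|² + |∇u|²) dx)^{1/2}` is equivalent to the `E_β^1(K)`-norm:
there are constants `c₁, c₂ > 0` with
`c₁ ∫_K ((|x|^{2β}+|x|^{2β−2})|u|² + |x|^{2β}|∇u|²) dx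
  ≤ ∫_K |x|^{2β}(|u|² + |∇u|²) dx
  ≤ c₂ ∫_K ((|x|^{2β}+|x|^{2β−2})|u|² + |x|^{2β}|∇u|²) dx`. -/
theorem statement4
    (Ω : Set (EuclideanSpace ℝ (Fin 3)))
    (hΩsub : Ω ⊆ Metric.sphere 0 1)
    (hΩne : Ω.Nonempty)
    (hΩopen : ∃ U : Set (EuclideanSpace ℝ (Fin 3)), IsOpen U ∧ Ω = U ∩ Metric.sphere 0 1)
    (hΩcl : closure Ω ⊂ Metric.sphere 0 1)
    (K : Set (EuclideanSpace ℝ (Fin 3)))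
    (hK : K = {x | x ≠ 0 ∧ ‖x‖⁻¹ • x ∈ Ω})
    (β : ℝ) :
    ∃ c₁ > (0 : ℝ), ∃ c₂ > (0 : ℝ), ∀ u : EuclideanSpace ℝ (Fin 3) → ℝ,
      ContDiff ℝ (⊤ : ℕ∞) u → HasCompactSupport u → tsupport u ⊆ K →
      (c₁ * ∫ x in K, ((‖x‖ ^ (2 * β) + ‖x‖ ^ (2 * β - 2)) * |u x| ^ 2
            + ‖x‖ ^ (2 * β) * ‖gradient u x‖ ^ 2)
          ≤ ∫ x in K, ‖x‖ ^ (2 * β) * (|u x| ^ 2 + ‖gradient u x‖ ^ 2))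
      ∧ (∫ x in K, ‖x‖ ^ (2 * β) * (|u x| ^ 2 + ‖gradient u x‖ ^ 2)
          ≤ c₂ * ∫ x in K, ((‖x‖ ^ (2 * β) + ‖x‖ ^ (2 * β - 2)) * |u x| ^ 2
            + ‖x‖ ^ (2 * β) * ‖gradient u x‖ ^ 2)) := by
  obtain ⟨q, hq, δ, hδ, hcone⟩ := S4.cone_bound Ω hΩsub hΩcl
  have hC : 0 < 1 + 4 * (1 + 2/δ)^2 := by positivity
  refine ⟨(1 + 4 * (1 + 2/δ)^2)⁻¹, by positivity, 1, one_pos, fun u hu huc hus => ?_⟩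
  have hu1 : ContDiff ℝ 1 u := hu.of_le (by exact_mod_cast le_top)
  have hne : ∀ x ∈ tsupport u, x ≠ 0 := fun x hx => by
    have := hus hx; rw [hK] at this; exact this.1
  have hbd : ∀ x ∈ tsupport u, δ * ‖x‖ ≤ ‖x‖ + inner ℝ q x := fun x hx => by
    have := hus hx; rw [hK] at this; exact hcone x this.1 this.2
  have hpos : ∀ x ∈ tsupport u, 0 < ‖x‖ + inner ℝ q x := fun x hx => by
    have := norm_pos_iff.2 (hne x hx)
    exact lt_of_lt_of_le (by positivity) (hbd x hx)
  have hu0 : ∀ x, x ∉ tsupport u → u x = 0 := fun x hx => image_eq_zero_of_notMem_tsupport hx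
  have hd0 : ∀ x, x ∉ tsupport u → fderiv ℝ u x = 0 := fun x hx => by
    by_contra h
    exact hx (support_fderiv_subset ℝ h)
  simp_rw [S4.norm_gradient, sq_abs]
  set P : S4.E → ℝ := fun x => (‖x‖ ^ (2 * β) + ‖x‖ ^ (2 * β - 2)) * u x ^ 2
            + ‖x‖ ^ (2 * β) * ‖fderiv ℝ u x‖ ^ 2 with hP
  set Q : S4.E → ℝ := fun x => ‖x‖ ^ (2 * β) * (u x ^ 2 + ‖fderiv ℝ u x‖ ^ 2) with hQ
  have hP0 : ∀ x, x ∉ tsupport u → P x = 0 := fun x hx => by simp [hP, hu0 x hx, hd0 x hx]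
  have hQ0 : ∀ x, x ∉ tsupport u → Q x = 0 := fun x hx => by simp [hQ, hu0 x hx, hd0 x hx]
  have hr : ∀ p : ℝ, ∀ x ∈ tsupport u, ContinuousAt (fun y : S4.E => ‖y‖ ^ p) x := fun p x hx =>
    continuous_norm.continuousAt.rpow_const (Or.inl (norm_ne_zero_iff.2 (hne x hx)))
  have hcu : Continuous u := hu1.continuous
  have hcd : Continuous (fderiv ℝ u) := hu1.continuous_fderiv (by norm_num)
  have hcu2 : Continuous (fun x => u x ^ 2) := hcu.pow 2
  have hcd2 : Continuous (fun x => ‖fderiv ℝ u x‖ ^ 2) := hcd.norm.pow 2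
  have hPi : Integrable P := S4.integrable_cut u P huc (fun x hx =>
    (((hr _ x hx).add (hr _ x hx)).mul hcu2.continuousAt).add
      ((hr _ x hx).mul hcd2.continuousAt)) hP0
  have hQi : Integrable Q := S4.integrable_cut u Q huc (fun x hx =>
    (hr _ x hx).mul (hcu2.continuousAt.add hcd2.continuousAt)) hQ0
  have hKP : ∫ x in K, P x = ∫ x, P x :=
    setIntegral_eq_integral_of_forall_compl_eq_zero fun x hx => hP0 x fun h => hx (hus h)
  have hKQ : ∫ x in K, Q x = ∫ x, Q x :=
    setIntegral_eq_integral_of_forall_compl_eq_zero fun x hx => hQ0 x fun h => hx (hus h)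
  rw [hKP, hKQ]
  have hH0 : ∀ i x, x ∉ tsupport u → S4.H β q u i x = 0 := fun i x hx => by
    simp [S4.H, hu0 x hx]
  have hHc : ∀ i, ContDiff ℝ 1 (S4.H β q u i) := fun i =>
    S4.contDiff_cut u _ (fun x hx => S4.contDiffAt_H β q x u (hne x hx) (hpos x hx)
      hu1.contDiffAt i) (hH0 i)
  have hHs : ∀ i, HasCompactSupport (S4.H β q u i) := fun i =>
    HasCompactSupport.intro' huc (isClosed_tsupport u) (hH0 i)
  have hI := fun i => S4.integral_fderiv_zero _ (hHc i) (hHs i) (EuclideanSpace.single i 1)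
  set φ : S4.E → ℝ := fun x =>
    ∑ i, fderiv ℝ (S4.H β q u i) x (EuclideanSpace.single i 1) with hφ
  have hφi : Integrable φ := integrable_finsetSum _ fun i _ => (hI i).1
  have hφ0 : ∫ x, φ x = 0 := by
    rw [hφ, integral_finsetSum _ fun i _ => (hI i).1]
    exact Finset.sum_eq_zero fun i _ => (hI i).2
  have hφz : ∀ x, x ∉ tsupport u → φ x = 0 := fun x hx => by
    refine Finset.sum_eq_zero fun i _ => ?_
    have : S4.H β q u i =ᶠ[nhds x] fun _ => 0 := by
      filter_upwards [(isClosed_tsupport u).isOpen_compl.mem_nhds hx] with y hy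
      exact hH0 i y hy
    rw [this.fderiv_eq]
    simp
  constructor
  · have hle : ∫ x, P x ≤ ∫ x, (2 * φ x + (1 + 4 * (1 + 2/δ)^2) * Q x) := by
      refine integral_mono hPi ((hφi.const_mul 2).add (hQi.const_mul _)) fun x => ?_
      by_cases hx : x ∈ tsupport u
      · have h := S4.pointwise β δ q x u hq (hne x hx) hδ (hbd x hx)
          (hu1.differentiable (by norm_num) x)
        have h2 : 0 ≤ 4 * (1 + 2/δ)^2 * (‖x‖ ^ (2*β) * u x ^ 2) := by positivity
        simp only [hP, hQ, hφ]
        linarith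
      · simp [hP0 x hx, hQ0 x hx, hφz x hx]
    rw [integral_add (hφi.const_mul 2) (hQi.const_mul _), integral_const_mul, integral_const_mul,
      hφ0] at hle
    rw [inv_mul_le_iff₀ hC]
    linarith
  · rw [one_mul]
    refine integral_mono hQi hPi fun x => ?_
    have : 0 ≤ ‖x‖ ^ (2 * β - 2) * u x ^ 2 := by positivity
    simp only [hP, hQ]
    linarith
end
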